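/- arXiv:2305.06285 — 3 statements merged into one kernel-verified Lean document; each statement's English description precedes it below -/
import Mathlib

section
/- Let O be a non-trivial m-ovoid of the Hermitian polar space H(4,q²), with q > 2. Then m ≥ (−3q − 3 + √(4q⁵ − 4q⁴ + 5q² − 2q + 1))/(2(q² − q − 2)). -/
noncomputable section

open scoped BigOperators

namespace PolarOvoids

/-- The kind of the polar space `P'_{r,e}`: the elliptic quadric `Q⁻(2r+1,q)` (`e = 2`),
the symplectic polar space `W(2r-1,q)` (`e = 1`), or the Hermitian polar space `H(2r,q)`
with `q` a square (`e = 3/2`). -/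
inductive PolarKind : Type where
  | elliptic
  | symplectic
  | hermitian

/-- The parameter `e` of the polar space. -/
def PolarKind.e : PolarKind → ℝ
  | .elliptic => 2
  | .symplectic => 1
  | .hermitian => 3 / 2

/-- The dimension `2r + 2e - 2` of the vector space underlying the ambient projective
space `PG(n,q)`, `n = 2r + 2e - 3`. -/
def PolarKind.vdim : PolarKind → ℕ → ℕ
  | .elliptic, r => 2 * r + 2
  | .symplectic, r => 2 * r
  | .hermitian, r => 2 * r + 1

/-- The orthogonal complement (polar image) of a subspace with respect to a
(reflexive) sesquilinear form `B`. -/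
def sperp {F V : Type} [Field F] [AddCommGroup V] [Module F V] {σ : F →+* F}
    (B : V →ₗ[F] V →ₛₗ[σ] F) (W : Submodule F V) : Submodule F V where
  carrier := {v | ∀ w ∈ W, B w v = 0}
  add_mem' := by
    intro a b ha hb w hw
    simp only [map_add, ha w hw, hb w hw, add_zero]
  zero_mem' := by
    intro w hw
    simp
  smul_mem' := by
    intro c v hv w hw
    simp only [map_smulₛₗ, hv w hw, smul_zero]

/-- The set of points of the projective space `PG(n,q)` lying in a projective subspace,
given as the corresponding linear subspace `W`. -/
def pts {F V : Type} [Field F] [AddCommGroup V] [Module F V] (W : Submodule F V) :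
    Set (Projectivization F V) := {p | p.rep ∈ W}

/-- The total weight `μ(S) = ∑_{p ∈ S} μ(p)` of a set `S` of projective points under a
weight function `μ` on the points. -/
def wsum {F V : Type} [Field F] [AddCommGroup V] [Module F V]
    (μ : Projectivization F V → ℕ) (S : Set (Projectivization F V)) : ℝ :=
  ∑ᶠ p ∈ S, (μ p : ℝ)

/-- The weight `μ(S) = |S ∩ O|` of a point set `S` with respect to the point set `O`. -/
def nwt {X : Type} (O S : Set X) : ℝ := ((S ∩ O).ncard : ℝ)

/-- The defining property of each kind of polar space, in terms of the companion
automorphism `σ`, the sesquilinear form `B` inducing the polarity, the point set `sing`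
of the polar space and the predicate `ti` of total isotropy (resp. total singularity):
* symplectic: `B` is a non-degenerate alternating bilinear form;
* Hermitian: `B` is a non-degenerate Hermitian form with respect to the involutory field
  automorphism `σ` (so the field order is a square `q` and `σ : x ↦ x^√q`);
* elliptic: `B` is the bilinear form associated to a non-singular quadratic form `Q`,
  of Witt index `r` (imposed by the rank axioms below). -/
def PolarKind.Spec {F : Type} [Field F] {N : ℕ} :
    (k : PolarKind) → (σ : F →+* F) →
    ((Fin N → F) →ₗ[F] (Fin N → F) →ₛₗ[σ] F) →
    Set (Projectivization F (Fin N → F)) →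
    (Submodule F (Fin N → F) → Prop) → Prop
  | .symplectic, σ, B, sing, ti =>
      σ = RingHom.id F ∧ (∀ v, B v v = 0) ∧ sing = Set.univ ∧
        ∀ W, ti W ↔ ∀ v ∈ W, ∀ w ∈ W, B v w = 0
  | .hermitian, σ, B, sing, ti =>
      σ ≠ RingHom.id F ∧ σ.comp σ = RingHom.id F ∧
        (∀ v w, B w v = σ (B v w)) ∧
        sing = {p | B p.rep p.rep = 0} ∧
        ∀ W, ti W ↔ ∀ v ∈ W, ∀ w ∈ W, B v w = 0
  | .elliptic, σ, B, sing, ti =>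
      σ = RingHom.id F ∧
        ∃ Q : QuadraticForm F (Fin N → F),
          (∀ v w, QuadraticMap.polar (⇑Q) v w = B v w) ∧
          sing = {p | Q p.rep = 0} ∧
          ∀ W, ti W ↔ ∀ v ∈ W, Q v = 0

/-- A finite classical polar space `P'_{r,e}` of rank `r` and kind `k` over the finite
field `F` (of order `q`), consisting of the totally isotropic (resp. totally singular)
subspaces with respect to the defining form.  Its ambient projective space is
`PG(2r + 2e - 3, q)`, whose points are the points of `Projectivization F (Fin (k.vdim r) → F)`
and whose `j`-dimensional projective subspaces correspond to the linear subspaces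
`W : Submodule F (Fin (k.vdim r) → F)` with `Module.finrank F W = j + 1`.
The polarity `⊥` of the ambient projective space is induced by the non-degenerate
reflexive (sesquilinear) form `B`; the rank axioms state that the Witt index is `r`,
i.e. generators have projective dimension `r - 1`. -/
structure PolarSpace (F : Type) [Field F] (r : ℕ) (k : PolarKind) where
  σ : F →+* F
  B : (Fin (k.vdim r) → F) →ₗ[F] (Fin (k.vdim r) → F) →ₛₗ[σ] F
  nondeg : ∀ v, (∀ w, B v w = 0) → v = 0
  sing : Set (Projectivization F (Fin (k.vdim r) → F))
  ti : Submodule F (Fin (k.vdim r) → F) → Prop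
  spec : k.Spec σ B sing ti
  rank_exists : ∃ W, ti W ∧ Module.finrank F ↥W = r
  rank_le : ∀ W, ti W → Module.finrank F ↥W ≤ r

namespace PolarSpace

variable {F : Type} [Field F] {r : ℕ} {k : PolarKind}

/-- The image `π^⊥` of a subspace `π` under the polarity of the ambient projective space. -/
def perp (P : PolarSpace F r k) (W : Submodule F (Fin (k.vdim r) → F)) :
    Submodule F (Fin (k.vdim r) → F) := sperp P.B W

/-- The image `p^⊥` of a point `p` under the polarity of the ambient projective space. -/
def pperp (P : PolarSpace F r k) (p : Projectivization F (Fin (k.vdim r) → F)) :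
    Submodule F (Fin (k.vdim r) → F) := sperp P.B (Submodule.span F {p.rep})

/-- A generator: a maximal totally isotropic (totally singular) subspace, i.e. one of
projective dimension `r - 1`. -/
def IsGenerator (P : PolarSpace F r k) (W : Submodule F (Fin (k.vdim r) → F)) : Prop :=
  P.ti W ∧ Module.finrank F ↥W = r

/-- An `m`-ovoid: a set `O` of points of the polar space such that every generator
contains exactly `m` points of `O`. -/
def IsMOvoid (P : PolarSpace F r k) (m : ℕ)
    (O : Set (Projectivization F (Fin (k.vdim r) → F))) : Prop :=
  O ⊆ P.sing ∧ ∀ W, P.IsGenerator W → (pts W ∩ O).ncard = m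

/-- A non-trivial `m`-ovoid: an `m`-ovoid with `0 < m < θ_{r-1} = (q^r - 1)/(q - 1)`,
the number of points of a generator. -/
def IsNontrivialMOvoid [Fintype F] (P : PolarSpace F r k) (m : ℕ)
    (O : Set (Projectivization F (Fin (k.vdim r) → F))) : Prop :=
  P.IsMOvoid m O ∧ 0 < m ∧ m < ∑ i ∈ Finset.range r, Fintype.card F ^ i

/-- A weighted `m`-ovoid: a function `μ` assigning a natural number to each point of the
ambient projective space, vanishing on points not in the polar space, such that
`μ(p^⊥) + q^{r+e-2}·μ(p) = m·(q^{r+e-2} + 1)` for every point `p` of `PG(n,q)`. -/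
def IsWeightedMOvoid [Fintype F] (P : PolarSpace F r k) (m : ℕ)
    (μ : Projectivization F (Fin (k.vdim r) → F) → ℕ) : Prop :=
  (∀ p, p ∉ P.sing → μ p = 0) ∧
  ∀ p, wsum μ (pts (P.pperp p)) +
      (Fintype.card F : ℝ) ^ ((r : ℝ) + k.e - 2) * (μ p : ℝ)
    = (m : ℝ) * ((Fintype.card F : ℝ) ^ ((r : ℝ) + k.e - 2) + 1)

end PolarSpace

section InvolutionCounts

variable {F : Type} [Field F] [Fintype F] {q : ℕ} {σ : F →+* F}

theorem one_lt_of_card_eq_sq (hq : Fintype.card F = q ^ 2) : 1 < q := by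
  have h := Fintype.one_lt_card (α := F)
  rw [hq] at h
  by_contra h1
  interval_cases q <;> simp_all

/-- The fixed field of an involution of a field with `q ^ 2` elements has `q` elements. -/
theorem card_fixed_of_involution (hq : Fintype.card F = q ^ 2) (hσ : σ ≠ RingHom.id F)
    (hσσ : ∀ x, σ (σ x) = x) : Nat.card {x : F // σ x = x} = q := by
  obtain ⟨e, he⟩ : ∃ e, σ e ≠ e := by
    by_contra! h
    exact hσ (RingHom.ext h)
  have hd : e - σ e ≠ 0 := sub_ne_zero.2 (Ne.symm he)
  have hb : ∀ x, σ ((x - σ x) / (e - σ e)) = (x - σ x) / (e - σ e) := fun x => by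
    rw [map_div₀, map_sub, map_sub, hσσ, hσσ, ← neg_sub x, ← neg_sub e, neg_div_neg_eq]
  let f : {x : F // σ x = x} × {x : F // σ x = x} → F := fun a => a.1.1 + a.2.1 * e
  have hf : Function.Bijective f := by
    constructor
    · rintro ⟨⟨a, ha⟩, ⟨b, hb⟩⟩ ⟨⟨a', ha'⟩, ⟨b', hb'⟩⟩ h
      simp only [f] at h
      have h2 := congrArg σ h
      simp only [map_add, map_mul, ha, hb, ha', hb'] at h2
      have h3 : (b - b') * (e - σ e) = 0 := by linear_combination h - h2
      have h4 : b = b' := sub_eq_zero.1 ((mul_eq_zero.1 h3).resolve_right hd)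
      subst h4
      have h5 : a = a' := by linear_combination h
      subst h5
      rfl
    · intro x
      refine ⟨⟨⟨x - (x - σ x) / (e - σ e) * e, ?_⟩, ⟨_, hb x⟩⟩, by simp [f]⟩
      rw [map_sub, map_mul, hb]
      field_simp
      ring
  have h := Nat.card_eq_of_bijective f hf
  rw [Nat.card_prod, Nat.card_eq_fintype_card (α := F), hq, ← sq] at h
  exact Nat.pow_left_injective two_ne_zero h

/-- In a field with `q ^ 2` elements and an involution `σ`, a non-zero fixed element is the norm
of exactly `q + 1` elements. -/
theorem card_norm_eq [DecidableEq F] (hq : Fintype.card F = q ^ 2) (hσ : σ ≠ RingHom.id F)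
    (hσσ : ∀ x, σ (σ x) = x) {s : F} (hs : σ s = s) (hs0 : s ≠ 0) :
    (Finset.univ.filter fun t : F => t * σ t = s).card = q + 1 := by
  have hq1 : 1 < q := one_lt_of_card_eq_sq hq
  let τ : Fˣ →* Fˣ := Units.map (σ : F →* F)
  let N : Fˣ →* Fˣ := MonoidHom.id _ * τ
  let D : Fˣ →* Fˣ := MonoidHom.id _ / τ
  have hN : ∀ x : Fˣ, ((N x : Fˣ) : F) = x * σ x := fun x => rfl
  have hDk : ∀ x : Fˣ, x ∈ D.ker ↔ σ x = x := fun x => by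
    rw [MonoidHom.mem_ker, MonoidHom.div_apply, div_eq_one, Units.ext_iff]
    exact eq_comm
  have hND : N.ker = D.range := by
    ext x
    constructor
    · intro hx
      have hx1 : (x : F) * σ x = 1 := by rw [← hN, MonoidHom.mem_ker.1 hx]; rfl
      obtain ⟨c, hc⟩ : ∃ c, c + x * σ c ≠ 0 := by
        by_contra! h
        have h1 := h 1
        rw [map_one, mul_one] at h1
        apply hσ
        ext c
        have h2 := h c
        rw [eq_neg_of_add_eq_zero_right h1] at h2
        simp only [RingHom.id_apply]
        linear_combination -h2
      refine ⟨Units.mk0 _ hc, ?_⟩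
      rw [MonoidHom.div_apply, div_eq_iff_eq_mul, Units.ext_iff]
      change c + x * σ c = x * σ (c + x * σ c)
      rw [map_add, map_mul, hσσ]
      linear_combination (-c) * hx1
    · rintro ⟨y, rfl⟩
      rw [MonoidHom.mem_ker, Units.ext_iff, hN, MonoidHom.div_apply]
      have h1 : ((MonoidHom.id Fˣ y / τ y : Fˣ) : F) = y / σ y := by
        rw [Units.val_div_eq_div_val]; rfl
      rw [h1, map_div₀, hσσ]
      simp
  have hDcard : Nat.card D.ker + 1 = q := by
    have h1 : {x : F | σ x = x} = insert 0 (Units.val '' (D.ker : Set Fˣ)) := by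
      ext x
      simp only [Set.mem_ofPred_eq, Set.mem_insert_iff, Set.mem_image, SetLike.mem_coe, hDk]
      constructor
      · intro h
        by_cases h0 : x = 0
        · exact Or.inl h0
        · exact Or.inr ⟨Units.mk0 x h0, h, rfl⟩
      · rintro (rfl | ⟨y, hy, rfl⟩)
        · exact map_zero σ
        · exact hy
    rw [← card_fixed_of_involution hq hσ hσσ]
    change _ = Nat.card ({x : F | σ x = x} : Set F)
    rw [Nat.card_coe_set_eq, h1, Set.ncard_insert_of_notMem (by simp),
      Set.ncard_image_of_injective _ Units.val_injective, ← Nat.card_coe_set_eq]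
    rfl
  have hG : Nat.card Fˣ + 1 = q ^ 2 := by
    rw [Nat.card_units, Nat.card_eq_fintype_card, hq]
    have : 0 < q ^ 2 := by positivity
    omega
  have hD : Nat.card D.ker * Nat.card D.range = Nat.card Fˣ := by
    rw [← Subgroup.index_ker, Subgroup.card_mul_index]
  have hN' : Nat.card N.ker * Nat.card N.range = Nat.card Fˣ := by
    rw [← Subgroup.index_ker, Subgroup.card_mul_index]
  have hNk : Nat.card N.ker = q + 1 := by
    rw [hND]
    obtain ⟨k, rfl⟩ : ∃ k, q = k + 1 := ⟨_, hDcard.symm⟩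
    have hk : Nat.card D.ker = k := by omega
    rw [hk] at hD
    have : k * Nat.card D.range = k * (k + 1 + 1) := by
      rw [hD]; nlinarith
    exact Nat.eq_of_mul_eq_mul_left (by omega) this
  have hNr : Nat.card N.range = Nat.card D.ker := by
    rw [hNk] at hN'
    have : (q + 1) * Nat.card N.range = (q + 1) * Nat.card D.ker := by
      rw [hN']; nlinarith
    exact Nat.eq_of_mul_eq_mul_left (by omega) this
  have hle : N.range ≤ D.ker := by
    rintro _ ⟨x, rfl⟩
    rw [hDk, hN, map_mul, hσσ, mul_comm]
  have hrange : N.range = D.ker := Subgroup.eq_of_le_of_card_ge hle hNr.ge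
  obtain ⟨t₀, ht₀⟩ : Units.mk0 s hs0 ∈ N.range := by
    rw [hrange, hDk]; exact hs
  have ht₀' : (t₀ : F) * σ t₀ = s := by rw [← hN, ht₀]; rfl
  have himg : ((Finset.univ.filter fun t : F => t * σ t = s) : Set F) =
      (fun u : Fˣ => (t₀ : F) * u) '' (N.ker : Set Fˣ) := by
    ext t
    simp only [Finset.coe_filter, Finset.mem_univ, true_and, Set.mem_ofPred_eq, Set.mem_image,
      SetLike.mem_coe, MonoidHom.mem_ker]
    constructor
    · intro h
      have h0 : t ≠ 0 := by rintro rfl; simp at h; exact hs0 h.symm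
      refine ⟨t₀⁻¹ * Units.mk0 t h0, ?_, by simp⟩
      have h1 : N (Units.mk0 t h0) = N t₀ := by
        rw [ht₀, Units.ext_iff, hN]; exact h
      rw [map_mul, map_inv, h1, inv_mul_cancel]
    · rintro ⟨u, hu, rfl⟩
      have hu' : (u : F) * σ u = 1 := by rw [← hN, hu]; rfl
      rw [map_mul]
      linear_combination (u : F) * σ u * ht₀' + s * hu'
  rw [← Set.ncard_coe_finset, himg, Set.ncard_image_of_injective, ← hNk, ← Nat.card_coe_set_eq]
  · rfl
  · intro a b h
    exact Units.ext (mul_left_cancel₀ t₀.ne_zero h)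

end InvolutionCounts

section HermitianCounts

open Classical

variable {F V : Type} [Field F] [AddCommGroup V] [Module F V] {σ : F →+* F}
  {B : V →ₗ[F] V →ₛₗ[σ] F}

theorem mem_sperp_singleton (hB : ∀ v w, B w v = σ (B v w)) {p v : V} :
    v ∈ sperp B (Submodule.span F {p}) ↔ B v p = 0 := by
  constructor
  · intro h
    rw [hB p v, h p (Submodule.mem_span_singleton_self p), map_zero]
  · intro h w hw
    obtain ⟨c, rfl⟩ := Submodule.mem_span_singleton.1 hw
    rw [map_smul, LinearMap.smul_apply, hB v p, h, map_zero, smul_zero]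

theorem finrank_inf_sperp_singleton [FiniteDimensional F V] (hB : ∀ v w, B w v = σ (B v w))
    {W : Submodule F V} {p w : V} (hw : w ∈ W) (hwp : B w p ≠ 0) :
    Module.finrank F ↥(W ⊓ sperp B (Submodule.span F {p})) + 1 = Module.finrank F W := by
  let f : W →ₗ[F] F := (B.flip p).comp W.subtype
  have hf : f ≠ 0 := fun h => hwp (by simpa [f] using LinearMap.congr_fun h ⟨w, hw⟩)
  have hk : W ⊓ sperp B (Submodule.span F {p}) = (LinearMap.ker f).map W.subtype := by
    ext v
    simp only [Submodule.mem_inf, mem_sperp_singleton hB, Submodule.mem_map, LinearMap.mem_ker, f]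
    constructor
    · rintro ⟨h1, h2⟩
      exact ⟨⟨v, h1⟩, h2, rfl⟩
    · rintro ⟨y, hy, rfl⟩
      exact ⟨y.2, hy⟩
  rw [hk, Submodule.finrank_map_subtype_eq]
  exact Module.Dual.finrank_ker_add_one_of_ne_zero hf

/-- A subspace all of whose vectors are isotropic is totally isotropic. -/
theorem apply_eq_zero_of_isotropic (hσ : σ ≠ RingHom.id F)
    (hB : ∀ v w, B w v = σ (B v w)) {W : Submodule F V} (h : ∀ v ∈ W, B v v = 0)
    {v w : V} (hv : v ∈ W) (hw : w ∈ W) : B v w = 0 := by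
  obtain ⟨e, he⟩ : ∃ e, σ e ≠ e := by
    by_contra! h
    exact hσ (RingHom.ext h)
  have key : ∀ c, σ c * B v w + c * σ (B v w) = 0 := fun c => by
    have h1 := h (v + c • w) (W.add_mem hv (W.smul_mem c hw))
    simp only [map_add, map_smul, map_smulₛₗ, LinearMap.add_apply, LinearMap.smul_apply,
      h v hv, h w hw, smul_eq_mul, hB v w] at h1
    linear_combination h1
  have h1 := key 1
  rw [map_one] at h1
  have h2 : (σ e - e) * B v w = 0 := by linear_combination key e - e * h1
  exact (mul_eq_zero.1 h2).resolve_left (sub_ne_zero.2 he)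

theorem apply_eq_zero_of_mem_span_singleton {x y z : V} (hz : B x z = 0)
    (hy : y ∈ Submodule.span F {z}) : B x y = 0 := by
  obtain ⟨c, rfl⟩ := Submodule.mem_span_singleton.1 hy
  rw [map_smulₛₗ, hz, smul_zero]

/-- The radical of `z^⊥` is spanned by `z`, for an isotropic vector `z`. -/
theorem sperp_inf_sperp_sperp (hσσ : ∀ x, σ (σ x) = x) (hB : ∀ v w, B w v = σ (B v w))
    (hnd : ∀ v, (∀ w, B v w = 0) → v = 0) {z : V} (hz : B z z = 0) :
    sperp B (Submodule.span F {z}) ⊓ sperp B (sperp B (Submodule.span F {z})) =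
      Submodule.span F {z} := by
  ext u
  rw [Submodule.mem_inf, mem_sperp_singleton hB]
  constructor
  · rintro ⟨-, h⟩
    have hker : ⨅ _ : Unit, LinearMap.ker (B.flip z) ≤ LinearMap.ker (B.flip u) := by
      intro v hv
      rw [iInf_const] at hv
      exact h v ((mem_sperp_singleton hB).2 hv)
    have hspan := mem_span_of_iInf_ker_le_ker (L := fun _ : Unit => B.flip z) hker
    rw [Set.range_const, Submodule.mem_span_singleton] at hspan
    obtain ⟨c, hc⟩ := hspan
    refine Submodule.mem_span_singleton.2 ⟨σ c, ?_⟩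
    rw [← sub_eq_zero]
    refine hnd _ fun w => ?_
    rw [hB w, map_sub, map_smulₛₗ, hσσ]
    have h1 := LinearMap.congr_fun hc w
    simp only [LinearMap.smul_apply, LinearMap.flip_apply] at h1
    rw [h1, sub_self, map_zero]
  · intro hu
    refine ⟨?_, fun w hw => ?_⟩
    · rw [hB z u, apply_eq_zero_of_mem_span_singleton hz hu, map_zero]
    · exact apply_eq_zero_of_mem_span_singleton ((mem_sperp_singleton hB).1 hw) hu

variable [Fintype V]

/-- The number of isotropic vectors in a subspace. -/
def isoCount (B : V →ₗ[F] V →ₛₗ[σ] F) (W : Submodule F V) : ℕ :=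
  (Finset.univ.filter fun v : V => v ∈ W ∧ B v v = 0).card

theorem card_filter_mem [Fintype F] {q : ℕ} (hq : Fintype.card F = q ^ 2) (W : Submodule F V) :
    (Finset.univ.filter fun v : V => v ∈ W).card = q ^ (2 * Module.finrank F W) := by
  have h := Module.card_eq_pow_finrank (K := F) (V := W)
  rw [hq, ← pow_mul] at h
  rw [← h, Fintype.card_subtype]

/-- Splitting off a non-isotropic vector. -/
theorem isoCount_add_mul_isoCount [Fintype F] {q : ℕ} (hq : Fintype.card F = q ^ 2)
    (hσ : σ ≠ RingHom.id F) (hσσ : ∀ x, σ (σ x) = x)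
    (hB : ∀ v w, B w v = σ (B v w)) {W : Submodule F V} {p : V} (hp : p ∈ W) (hpp : B p p ≠ 0) :
    isoCount B W + q * isoCount B (W ⊓ sperp B (Submodule.span F {p})) =
      (q + 1) * q ^ (2 * Module.finrank F ↥(W ⊓ sperp B (Submodule.span F {p}))) := by
  have hHp : σ (B p p) = B p p := (hB p p).symm
  have hmem : ∀ {w}, w ∈ W ⊓ sperp B (Submodule.span F {p}) ↔ w ∈ W ∧ B w p = 0 := by
    intro w
    rw [Submodule.mem_inf, mem_sperp_singleton hB]
  have hexp : ∀ w t, B w p = 0 → B (w + t • p) (w + t • p) = B w w + t * σ t * B p p := by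
    intro w t h
    simp only [map_add, map_smul, map_smulₛₗ, LinearMap.add_apply, LinearMap.smul_apply, h,
      hB w p, smul_eq_mul, map_zero]
    ring
  have hcount : isoCount B W = ∑ w with w ∈ W ⊓ sperp B (Submodule.span F {p}),
      (Finset.univ.filter fun t : F => t * σ t = -(B w w / B p p)).card := by
    rw [isoCount, ← Finset.card_sigma]
    symm
    refine Finset.card_bij' (fun a _ => a.1 + a.2 • p)
      (fun v _ => ⟨v - (B v p / B p p) • p, B v p / B p p⟩) ?_ ?_ ?_ ?_
    · rintro ⟨w, t⟩ h
      simp only [Finset.mem_sigma, Finset.mem_filter, Finset.mem_univ, true_and, hmem] at h ⊢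
      refine ⟨W.add_mem h.1.1 (W.smul_mem _ hp), ?_⟩
      rw [hexp _ _ h.1.2, h.2]
      field_simp
      ring
    · intro v h
      simp only [Finset.mem_sigma, Finset.mem_filter, Finset.mem_univ, true_and, hmem] at h ⊢
      have h0 : B (v - (B v p / B p p) • p) p = 0 := by
        simp only [map_sub, map_smul, LinearMap.sub_apply, LinearMap.smul_apply, smul_eq_mul]
        field_simp
        ring
      refine ⟨⟨W.sub_mem h.1 (W.smul_mem _ hp), h0⟩, ?_⟩
      have h1 := hexp _ (B v p / B p p) h0
      rw [sub_add_cancel, h.2] at h1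
      field_simp at h1 ⊢
      linear_combination -h1
    · rintro ⟨w, t⟩ h
      simp only [Finset.mem_sigma, Finset.mem_filter, Finset.mem_univ, true_and, hmem] at h
      have : B (w + t • p) p / B p p = t := by
        simp only [map_add, map_smul, LinearMap.add_apply, LinearMap.smul_apply, smul_eq_mul,
          h.1.2]
        field_simp
        ring
      simp only [this, add_sub_cancel_right]
    · intro v _
      simp
  have hfib : ∀ w, (Finset.univ.filter fun t : F => t * σ t = -(B w w / B p p)).card +
      q * (if B w w = 0 then 1 else 0) = q + 1 := by
    intro w
    split_ifs with h
    · have : (Finset.univ.filter fun t : F => t * σ t = -(B w w / B p p)) = {0} := by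
        ext t
        simp [h]
      rw [this, Finset.card_singleton]
      ring
    · rw [card_norm_eq hq hσ hσσ]
      · ring
      · rw [map_neg, map_div₀, hHp, ← hB w w]
      · simp [h, hpp]
  have hiso : isoCount B (W ⊓ sperp B (Submodule.span F {p})) =
      ∑ w with w ∈ W ⊓ sperp B (Submodule.span F {p}), if B w w = 0 then 1 else 0 := by
    rw [isoCount, ← Finset.filter_filter, Finset.card_filter]
  rw [hcount, hiso, Finset.mul_sum, ← Finset.sum_add_distrib, Finset.sum_congr rfl fun w _ => hfib w,
    Finset.sum_const, card_filter_mem hq, smul_eq_mul, mul_comm]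

theorem mul_isoCount [Fintype F] {q : ℕ} (hq : Fintype.card F = q ^ 2)
    (hσ : σ ≠ RingHom.id F) (hσσ : ∀ x, σ (σ x) = x)
    (hB : ∀ v w, B w v = σ (B v w)) (W : Submodule F V) :
    (q : ℤ) * isoCount B W = q ^ (2 * Module.finrank F W) +
      (-1) ^ (Module.finrank F W + Module.finrank F ↥(W ⊓ sperp B W)) * (q - 1) *
        q ^ (Module.finrank F W + Module.finrank F ↥(W ⊓ sperp B W)) := by
  induction hn : Module.finrank F W generalizing W with
  | zero =>
    have hW := Submodule.finrank_eq_zero.1 hn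
    subst hW
    have h1 : isoCount B (⊥ : Submodule F V) = 1 := by
      rw [isoCount, Finset.card_eq_one]
      refine ⟨0, ?_⟩
      ext v
      simp +contextual
    rw [bot_inf_eq, finrank_bot, h1]
    push_cast
    ring
  | succ n ih =>
    by_cases hW : ∀ v ∈ W, B v v = 0
    · have hrad : W ⊓ sperp B W = W :=
        inf_eq_left.2 fun v hv w hw => apply_eq_zero_of_isotropic hσ hB hW hw hv
      have h1 : isoCount B W = q ^ (2 * Module.finrank F W) := by
        rw [← card_filter_mem hq, isoCount]
        congr 1
        ext v
        simpa using hW v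
      rw [hrad, h1, hn, Even.neg_one_pow ⟨_, rfl⟩]
      push_cast
      ring
    · push Not at hW
      obtain ⟨p, hp, hpp⟩ := hW
      have hmem : ∀ {w}, w ∈ W ⊓ sperp B (Submodule.span F {p}) ↔ w ∈ W ∧ B w p = 0 := by
        intro w
        rw [Submodule.mem_inf, mem_sperp_singleton hB]
      have hfin := finrank_inf_sperp_singleton hB hp hpp
      have hstep := isoCount_add_mul_isoCount hq hσ hσσ hB hp hpp
      have hrad : (W ⊓ sperp B (Submodule.span F {p})) ⊓
          sperp B (W ⊓ sperp B (Submodule.span F {p})) = W ⊓ sperp B W := by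
        ext v
        rw [Submodule.mem_inf, Submodule.mem_inf (q := sperp B W), hmem]
        constructor
        · rintro ⟨⟨hv, hvp⟩, h⟩
          refine ⟨hv, fun w hw => ?_⟩
          have h1 := h (w - (B w p / B p p) • p) (hmem.2
            ⟨W.sub_mem hw (W.smul_mem _ hp), by
              simp only [map_sub, map_smul, LinearMap.sub_apply, LinearMap.smul_apply, smul_eq_mul]
              field_simp
              ring⟩)
          simpa [hB v p, hvp] using h1
        · rintro ⟨hv, h⟩
          exact ⟨⟨hv, by rw [hB p v, h p hp, map_zero]⟩, fun w hw => h w (hmem.1 hw).1⟩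
      have h1 := ih (W ⊓ sperp B (Submodule.span F {p})) (by omega)
      rw [hrad] at h1
      rw [show Module.finrank F ↥(W ⊓ sperp B (Submodule.span F {p})) = n by omega] at hstep
      zify at hstep
      have h2 : (isoCount B W : ℤ) = (q + 1) * q ^ (2 * n) -
        q * isoCount B (W ⊓ sperp B (Submodule.span F {p})) := by linear_combination hstep
      rw [h2, h1]
      ring

section FiveDim

variable [Fintype F] {q : ℕ} (hq : Fintype.card F = q ^ 2)
  (hσ : σ ≠ RingHom.id F) (hσσ : ∀ x, σ (σ x) = x)
  (hB : ∀ v w, B w v = σ (B v w)) (hnd : ∀ v, (∀ w, B v w = 0) → v = 0)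
  (hV : Module.finrank F V = 5)

include hq hσ hσσ hB hnd hV in
theorem isoCount_top : (isoCount B ⊤ : ℤ) = q ^ 9 - q ^ 5 + q ^ 4 := by
  have h := mul_isoCount hq hσ hσσ hB ⊤
  have hrad : (⊤ : Submodule F V) ⊓ sperp B ⊤ = ⊥ := by
    rw [top_inf_eq, eq_bot_iff]
    intro v hv
    exact (Submodule.mem_bot F).2 (hnd v fun w => by rw [hB w v, hv w trivial, map_zero])
  rw [hrad, finrank_bot, finrank_top, hV] at h
  have hq0 : (q : ℤ) ≠ 0 := by exact_mod_cast (one_lt_of_card_eq_sq hq).ne_zero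
  refine mul_left_cancel₀ hq0 ?_
  rw [h]
  ring

omit [Fintype F] in
include hB hnd hV in
theorem finrank_sperp_singleton {z : V} (hz0 : z ≠ 0) :
    Module.finrank F ↥(sperp B (Submodule.span F {z})) = 4 := by
  obtain ⟨w, hw⟩ : ∃ w, B w z ≠ 0 := by
    by_contra! h
    exact hz0 (hnd z fun w => by rw [hB w z, h, map_zero])
  have h := finrank_inf_sperp_singleton hB (W := ⊤) (Submodule.mem_top (x := w)) hw
  rw [top_inf_eq, finrank_top, hV] at h
  omega

include hq hσ hσσ hB hnd hV in
theorem isoCount_sperp_isotropic {z : V} (hz0 : z ≠ 0) (hz : B z z = 0) :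
    (isoCount B (sperp B (Submodule.span F {z})) : ℤ) = q ^ 7 - q ^ 5 + q ^ 4 := by
  have h := mul_isoCount hq hσ hσσ hB (sperp B (Submodule.span F {z}))
  rw [sperp_inf_sperp_sperp hσσ hB hnd hz, finrank_sperp_singleton hB hnd hV hz0,
    finrank_span_singleton hz0] at h
  have hq0 : (q : ℤ) ≠ 0 := by exact_mod_cast (one_lt_of_card_eq_sq hq).ne_zero
  refine mul_left_cancel₀ hq0 ?_
  rw [h]
  ring

include hq hσ hσσ hB hnd hV in
theorem isoCount_sperp_anisotropic {p : V} (hp : B p p ≠ 0) :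
    (isoCount B (sperp B (Submodule.span F {p})) : ℤ) = q ^ 7 + q ^ 4 - q ^ 3 := by
  have hp0 : p ≠ 0 := by rintro rfl; simp at hp
  have h := isoCount_add_mul_isoCount hq hσ hσσ hB (W := ⊤) (Submodule.mem_top (x := p)) hp
  rw [top_inf_eq, finrank_sperp_singleton hB hnd hV hp0] at h
  zify at h
  rw [isoCount_top hq hσ hσσ hB hnd hV] at h
  have hq0 : (q : ℤ) ≠ 0 := by exact_mod_cast (one_lt_of_card_eq_sq hq).ne_zero
  refine mul_left_cancel₀ hq0 ?_
  linear_combination h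

include hq hσ hσσ hB hnd hV in
theorem isoCount_sperp_inf_sperp {p z : V} (hp : B p p ≠ 0) (hz0 : z ≠ 0) (hz : B z z = 0)
    (hpz : B p z = 0) :
    (isoCount B (sperp B (Submodule.span F {p}) ⊓ sperp B (Submodule.span F {z})) : ℤ) =
      q ^ 5 + q ^ 4 - q ^ 3 := by
  have hmem : p ∈ sperp B (Submodule.span F {z}) := (mem_sperp_singleton hB).2 hpz
  have h := isoCount_add_mul_isoCount hq hσ hσσ hB hmem hp
  have hfin := finrank_inf_sperp_singleton hB hmem hp
  rw [inf_comm, finrank_sperp_singleton hB hnd hV hz0] at hfin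
  rw [inf_comm (sperp B (Submodule.span F {z})), show Module.finrank F ↥(sperp B (Submodule.span F {p}) ⊓
    sperp B (Submodule.span F {z})) = 3 by omega] at h
  zify at h
  rw [isoCount_sperp_isotropic hq hσ hσσ hB hnd hV hz0 hz] at h
  have hq0 : (q : ℤ) ≠ 0 := by exact_mod_cast (one_lt_of_card_eq_sq hq).ne_zero
  refine mul_left_cancel₀ hq0 ?_
  linear_combination h

end FiveDim

section Cone

theorem mem_span_singleton_comm {u v : V} (hu : u ≠ 0) (h : u ∈ Submodule.span F {v}) :
    v ∈ Submodule.span F {u} := by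
  obtain ⟨c, rfl⟩ := Submodule.mem_span_singleton.1 h
  have hc : c ≠ 0 := by rintro rfl; simp at hu
  exact Submodule.mem_span_singleton.2 ⟨c⁻¹, by rw [smul_smul, inv_mul_cancel₀ hc, one_smul]⟩

omit [Fintype V] in
theorem finrank_span_pair {z w : V} (hz : z ≠ 0) (hw : w ∉ Submodule.span F {z}) :
    Module.finrank F (Submodule.span F {z, w}) = 2 := by
  have hli : LinearIndependent F ![z, w] := by
    rw [LinearIndependent.pair_iff' hz]
    exact fun a h => hw (Submodule.mem_span_singleton.2 ⟨a, h⟩)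
  have h := finrank_span_eq_card hli
  rwa [Matrix.range_cons_cons_empty, Fintype.card_fin] at h

omit [Fintype V] in
theorem mem_span_pair_exchange {z u w : V} (hu : u ∈ Submodule.span F {z, w})
    (huz : u ∉ Submodule.span F {z}) : w ∈ Submodule.span F {z, u} := by
  rw [Set.pair_comm] at hu ⊢
  exact mem_span_insert_exchange hu huz

variable [Fintype F] {q m : ℕ} (hq : Fintype.card F = q ^ 2)
  (hσ : σ ≠ RingHom.id F) (hσσ : ∀ x, σ (σ x) = x)
  (hB : ∀ v w, B w v = σ (B v w)) (hnd : ∀ v, (∀ w, B v w = 0) → v = 0)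
  (hV : Module.finrank F V = 5)
  (Ω : Finset V) (hne : ∀ u ∈ Ω, u ≠ 0) (hiso : ∀ u ∈ Ω, B u u = 0)
  (hsmul : ∀ u ∈ Ω, ∀ c : F, c ≠ 0 → c • u ∈ Ω)
  (hline : ∀ z w, z ≠ 0 → w ∉ Submodule.span F {z} → B z z = 0 → B w w = 0 → B w z = 0 →
    ((Ω.filter fun u => u ∈ Submodule.span F {z, w}).card : ℤ) = m * (q ^ 2 - 1))

include hq in
theorem card_span_singleton {z : V} (hz : z ≠ 0) :
    (Finset.univ.filter fun u : V => u ∈ Submodule.span F {z}).card = q ^ 2 := by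
  rw [card_filter_mem hq, finrank_span_singleton hz]

include hq in
theorem card_span_singleton_ne_zero {z : V} (hz : z ≠ 0) :
    ((Finset.univ.filter fun u : V => u ≠ 0 ∧ u ∈ Submodule.span F {z}).card : ℤ) = q ^ 2 - 1 := by
  have h := card_span_singleton hq hz
  have h1 : (Finset.univ.filter fun u : V => u ≠ 0 ∧ u ∈ Submodule.span F {z}) =
      (Finset.univ.filter fun u : V => u ∈ Submodule.span F {z}).erase 0 := by
    ext u; simp
  rw [h1, Finset.cast_card_erase_of_mem (by simp), h]
  push_cast
  ring

include hq hne hsmul in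
theorem card_cone_inter_span {z : V} (hz : z ∈ Ω) :
    ((Ω.filter fun u => u ∈ Submodule.span F {z}).card : ℤ) = q ^ 2 - 1 := by
  rw [← card_span_singleton_ne_zero hq (hne z hz)]
  congr 2
  ext u
  simp only [Finset.mem_filter, Finset.mem_univ, true_and]
  refine ⟨fun h => ⟨hne u h.1, h.2⟩, fun ⟨h0, h⟩ => ⟨?_, h⟩⟩
  obtain ⟨c, rfl⟩ := Submodule.mem_span_singleton.1 h
  exact hsmul z hz c (by rintro rfl; simp at h0)

include hq hB hiso hline in
/-- Counting over the totally isotropic lines on `z` inside a subspace `U`. -/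
theorem cone_inter_perp_of_isotropic {U : Submodule F V} {z : V} (hz0 : z ≠ 0) (hz : B z z = 0)
    (hzU : z ∈ U) :
    (isoCount B (U ⊓ sperp B (Submodule.span F {z})) - q ^ 2 : ℤ) * (m * (q ^ 2 - 1)) =
      (isoCount B (U ⊓ sperp B (Submodule.span F {z})) - q ^ 2 : ℤ) *
        (Ω.filter fun u => u ∈ Submodule.span F {z}).card +
      (q ^ 4 - q ^ 2) * ((Ω.filter fun u => u ∈ U ∧ B u z = 0).card -
        (Ω.filter fun u => u ∈ Submodule.span F {z}).card) := by
  have hspan : ∀ {u}, u ∈ Submodule.span F {z} → u ∈ U ∧ B u z = 0 ∧ B u u = 0 := by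
    intro u hu
    obtain ⟨c, rfl⟩ := Submodule.mem_span_singleton.1 hu
    exact ⟨U.smul_mem c hzU, by simp [hz], by simp [hz]⟩
  set X := Finset.univ.filter fun w : V =>
    (w ∈ U ∧ B w z = 0 ∧ B w w = 0) ∧ w ∉ Submodule.span F {z} with hX
  have hXcard : (X.card : ℤ) = isoCount B (U ⊓ sperp B (Submodule.span F {z})) - q ^ 2 := by
    have h1 := Finset.card_filter_add_card_filter_not (s := Finset.univ.filter fun w : V =>
      w ∈ U ∧ B w z = 0 ∧ B w w = 0) (fun w => w ∈ Submodule.span F {z})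
    rw [Finset.filter_filter, Finset.filter_filter, ← hX] at h1
    have h2 : (Finset.univ.filter fun w : V => (w ∈ U ∧ B w z = 0 ∧ B w w = 0) ∧
        w ∈ Submodule.span F {z}) = Finset.univ.filter fun w : V => w ∈ Submodule.span F {z} := by
      ext w
      simp only [Finset.mem_filter, Finset.mem_univ, true_and]
      exact ⟨fun h => h.2, fun h => ⟨hspan h, h⟩⟩
    have h3 : (Finset.univ.filter fun w : V => w ∈ U ∧ B w z = 0 ∧ B w w = 0).card =
        isoCount B (U ⊓ sperp B (Submodule.span F {z})) := by
      rw [isoCount]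
      congr 1
      ext w
      simp only [Finset.mem_filter, Finset.mem_univ, true_and, Submodule.mem_inf,
        mem_sperp_singleton hB, and_assoc]
    rw [h2, h3, card_span_singleton hq hz0] at h1
    zify at h1
    linear_combination h1
  have hswap := Finset.sum_card_bipartiteAbove_eq_sum_card_bipartiteBelow
    (s := X) (t := Ω) (fun w u => u ∈ Submodule.span F {z, w})
  simp only [Finset.bipartiteAbove, Finset.bipartiteBelow] at hswap
  zify at hswap
  have hleft : ∀ w ∈ X, ((Ω.filter fun u => u ∈ Submodule.span F {z, w}).card : ℤ) =
      m * (q ^ 2 - 1) := by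
    intro w hw
    simp only [hX, Finset.mem_filter, Finset.mem_univ, true_and] at hw
    exact hline z w hz0 hw.2 hz hw.1.2.2 hw.1.2.1
  have hright : ∀ u ∈ Ω, ((X.filter fun w => u ∈ Submodule.span F {z, w}).card : ℤ) =
      (if u ∈ Submodule.span F {z} then (X.card : ℤ) - (q ^ 4 - q ^ 2) else 0) +
        (if u ∈ U ∧ B u z = 0 then (q : ℤ) ^ 4 - q ^ 2 else 0) := by
    intro u hu
    by_cases h1 : u ∈ Submodule.span F {z}
    · rw [if_pos h1, if_pos ⟨(hspan h1).1, (hspan h1).2.1⟩, Finset.filter_true_of_mem]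
      · ring
      · exact fun w _ => Submodule.span_mono (by simp) h1
    · rw [if_neg h1, zero_add]
      split_ifs with h2
      · have h3 : (X.filter fun w => u ∈ Submodule.span F {z, w}) =
            (Finset.univ.filter fun w : V => w ∈ Submodule.span F {z, u}) \
              (Finset.univ.filter fun w : V => w ∈ Submodule.span F {z}) := by
          ext w
          simp only [hX, Finset.mem_filter, Finset.mem_univ, true_and, Finset.mem_sdiff]
          constructor
          · rintro ⟨⟨-, hw⟩, huw⟩
            exact ⟨mem_span_pair_exchange huw h1, hw⟩
          · rintro ⟨hw, hwz⟩
            refine ⟨⟨?_, hwz⟩, mem_span_pair_exchange hw hwz⟩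
            obtain ⟨a, b, rfl⟩ := Submodule.mem_span_pair.1 hw
            have h4 : B z u = 0 := by rw [hB u z, h2.2, map_zero]
            exact ⟨U.add_mem (U.smul_mem _ hzU) (U.smul_mem _ h2.1), by simp [hz, h2.2],
              by simp [hz, h2.2, h4, hiso u hu]⟩
        have h4 : (Finset.univ.filter fun w : V => w ∈ Submodule.span F {z}) ⊆
            Finset.univ.filter fun w : V => w ∈ Submodule.span F {z, u} := by
          intro w
          simp only [Finset.mem_filter, Finset.mem_univ, true_and]
          exact fun h => Submodule.span_mono (by simp) h
        rw [h3, Finset.cast_card_sdiff h4, card_filter_mem hq, finrank_span_pair hz0 h1,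
          card_span_singleton hq hz0]
        push_cast
        ring
      · rw [Nat.cast_eq_zero, Finset.card_eq_zero, Finset.filter_eq_empty_iff]
        intro w hw huw
        simp only [hX, Finset.mem_filter, Finset.mem_univ, true_and] at hw
        obtain ⟨a, b, rfl⟩ := Submodule.mem_span_pair.1 huw
        exact h2 ⟨U.add_mem (U.smul_mem _ hzU) (U.smul_mem _ hw.1.1), by simp [hz, hw.1.2.1]⟩
  rw [Finset.sum_congr rfl hleft, Finset.sum_congr rfl hright, Finset.sum_add_distrib,
    ← Finset.sum_filter, ← Finset.sum_filter] at hswap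
  simp only [Finset.sum_const, nsmul_eq_mul] at hswap
  rw [hXcard] at hswap
  linear_combination hswap

include hq hB hne hiso hline in
/-- The number of vectors of the cone in a subspace all of whose isotropic points lie on the
same number of totally isotropic lines. -/
theorem cone_inter_subspace {U : Submodule F V} {I : ℤ}
    (hI : ∀ z ∈ U, z ≠ 0 → B z z = 0 → (isoCount B (U ⊓ sperp B (Submodule.span F {z})) : ℤ) = I)
    (hI0 : I ≠ q ^ 2) :
    ((Ω.filter fun u => u ∈ U).card : ℤ) * (q ^ 2 + 1) = m * (isoCount B U - 1) := by
  set Z := Finset.univ.filter fun z : V => z ≠ 0 ∧ z ∈ U ∧ B z z = 0 with hZ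
  have hZcard : (Z.card : ℤ) = isoCount B U - 1 := by
    have h1 : Z = (Finset.univ.filter fun z : V => z ∈ U ∧ B z z = 0).erase 0 := by
      ext z; simp [hZ]
    rw [h1, Finset.cast_card_erase_of_mem (by simp), isoCount]
  have hpoint : ∀ z ∈ Z, (I - q ^ 2) * (m * (q ^ 2 - 1)) =
      (I - q ^ 2 - (q ^ 4 - q ^ 2)) * (Ω.filter fun u => u ∈ Submodule.span F {z}).card +
      (q ^ 4 - q ^ 2) * ((Ω.filter fun u => u ∈ U ∧ B u z = 0).card : ℤ) := by
    intro z hz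
    simp only [hZ, Finset.mem_filter, Finset.mem_univ, true_and] at hz
    have h := cone_inter_perp_of_isotropic hq hB Ω hiso hline hz.1 hz.2.2 hz.2.1
    rw [hI z hz.2.1 hz.1 hz.2.2] at h
    linear_combination h
  have hsum := Finset.sum_congr rfl hpoint
  rw [Finset.sum_const, Finset.sum_add_distrib, ← Finset.mul_sum, ← Finset.mul_sum, nsmul_eq_mul,
    hZcard] at hsum
  have hspans : ∑ z ∈ Z, ((Ω.filter fun u => u ∈ Submodule.span F {z}).card : ℤ) =
      (Ω.filter fun u => u ∈ U).card * (q ^ 2 - 1) := by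
    have hswap := Finset.sum_card_bipartiteAbove_eq_sum_card_bipartiteBelow
      (s := Z) (t := Ω) (fun z u => u ∈ Submodule.span F {z})
    simp only [Finset.bipartiteAbove, Finset.bipartiteBelow] at hswap
    zify at hswap
    rw [hswap, ← nsmul_eq_mul, ← Finset.sum_const, Finset.sum_filter]
    refine Finset.sum_congr rfl fun u hu => ?_
    split_ifs with h
    · rw [← card_span_singleton_ne_zero hq (hne u hu)]
      congr 2
      ext z
      simp only [hZ, Finset.mem_filter, Finset.mem_univ, true_and]
      constructor
      · rintro ⟨h1, h2⟩
        exact ⟨h1.1, mem_span_singleton_comm (hne u hu) h2⟩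
      · rintro ⟨h1, h2⟩
        refine ⟨⟨h1, ?_⟩, mem_span_singleton_comm h1 h2⟩
        obtain ⟨c, rfl⟩ := Submodule.mem_span_singleton.1 h2
        exact ⟨U.smul_mem c h, by simp [hiso u hu]⟩
    · rw [Nat.cast_eq_zero, Finset.card_eq_zero, Finset.filter_eq_empty_iff]
      intro z hz huz
      simp only [hZ, Finset.mem_filter, Finset.mem_univ, true_and] at hz
      exact h ((Submodule.span_singleton_le_iff_mem _ _).2 hz.2.1 huz)
  have hperps : ∑ z ∈ Z, ((Ω.filter fun u => u ∈ U ∧ B u z = 0).card : ℤ) =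
      (Ω.filter fun u => u ∈ U).card * (I - 1) := by
    have hswap := Finset.sum_card_bipartiteAbove_eq_sum_card_bipartiteBelow
      (s := Z) (t := Ω.filter fun u => u ∈ U) (fun z u => B u z = 0)
    simp only [Finset.bipartiteAbove, Finset.bipartiteBelow, Finset.filter_filter] at hswap
    zify at hswap
    rw [hswap, ← nsmul_eq_mul, ← Finset.sum_const]
    refine Finset.sum_congr rfl fun u hu => ?_
    rw [Finset.mem_filter] at hu
    rw [← hI u hu.2 (hne u hu.1) (hiso u hu.1)]
    have h1 : (Z.filter fun z => B u z = 0) = (Finset.univ.filter fun z : V =>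
        z ∈ U ⊓ sperp B (Submodule.span F {u}) ∧ B z z = 0).erase 0 := by
      ext z
      simp only [hZ, Finset.mem_filter, Finset.mem_univ, true_and, Finset.mem_erase,
        Submodule.mem_inf, mem_sperp_singleton hB, hB u z, map_eq_zero]
      tauto
    rw [h1, Finset.cast_card_erase_of_mem (by simp), isoCount]
  rw [hspans, hperps] at hsum
  have hq1 : (q : ℤ) ^ 2 - 1 ≠ 0 := by
    have h := Fintype.one_lt_card (α := F)
    rw [hq] at h
    zify at h
    omega
  refine mul_left_cancel₀ (mul_ne_zero hq1 (sub_ne_zero.2 hI0)) ?_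
  linear_combination -hsum

section Sizes

include hq hσ hσσ hB hnd hV hne hiso hline

theorem card_cone : (Ω.card : ℤ) = m * (q ^ 2 - 1) * (q ^ 5 + 1) := by
  have hq2 : (2 : ℤ) ≤ q := by exact_mod_cast one_lt_of_card_eq_sq hq
  have hq1 : (0 : ℤ) < q ^ 2 - 1 := by nlinarith
  have h := cone_inter_subspace hq hB Ω hne hiso hline (U := ⊤)
    (I := q ^ 7 - q ^ 5 + q ^ 4) (fun z _ hz0 hz => by
      rw [top_inf_eq, isoCount_sperp_isotropic hq hσ hσσ hB hnd hV hz0 hz]) (by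
      intro h
      have : (0 : ℤ) < q ^ 2 * ((q ^ 2 - 1) * (q ^ 3 + 1)) := by positivity
      linarith)
  rw [isoCount_top hq hσ hσσ hB hnd hV] at h
  simp only [Submodule.mem_top, Finset.filter_true] at h
  refine mul_right_cancel₀ (b := (q : ℤ) ^ 2 + 1) (by positivity) ?_
  linear_combination h

theorem card_cone_perp_add {v : V} (hv : v ≠ 0) :
    ((Ω.filter fun u => B u v = 0).card : ℤ) +
      q ^ 3 * (Ω.filter fun u => u ∈ Submodule.span F {v}).card =
    m * (q ^ 2 - 1) * (q ^ 3 + 1) := by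
  have hq2 : (2 : ℤ) ≤ q := by exact_mod_cast one_lt_of_card_eq_sq hq
  have hq1 : (0 : ℤ) < q ^ 2 - 1 := by nlinarith
  by_cases hvv : B v v = 0
  · have h := cone_inter_perp_of_isotropic hq hB Ω hiso hline hv hvv (U := ⊤) trivial
    rw [top_inf_eq, isoCount_sperp_isotropic hq hσ hσσ hB hnd hV hv hvv] at h
    simp only [Submodule.mem_top, true_and] at h
    refine mul_left_cancel₀ (a := (q : ℤ) ^ 2 * (q ^ 2 - 1)) (by positivity) ?_
    linear_combination -h
  · have h := cone_inter_subspace hq hB Ω hne hiso hline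
      (U := sperp B (Submodule.span F {v}))
      (I := q ^ 5 + q ^ 4 - q ^ 3) (fun z hz hz0 hzz => by
        have : B v z = 0 := by rw [hB z v, (mem_sperp_singleton hB).1 hz, map_zero]
        rw [isoCount_sperp_inf_sperp hq hσ hσσ hB hnd hV hvv hz0 hzz this]) (by
        intro h
        have : (0 : ℤ) < q ^ 2 * ((q ^ 2 - 1) * (q + 1)) := by positivity
        linarith)
    rw [isoCount_sperp_anisotropic hq hσ hσσ hB hnd hV hvv] at h
    simp only [mem_sperp_singleton hB] at h
    have h0 : (Ω.filter fun u => u ∈ Submodule.span F {v}) = ∅ := by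
      rw [Finset.filter_eq_empty_iff]
      intro u hu huv
      obtain ⟨c, rfl⟩ := Submodule.mem_span_singleton.1 huv
      have hc : c ≠ 0 := by rintro rfl; simpa using hne _ hu
      have := hiso _ hu
      simp [hc, hvv] at this
    rw [h0, Finset.card_empty]
    refine mul_right_cancel₀ (b := (q : ℤ) ^ 2 + 1) (by positivity) ?_
    linear_combination h

include hsmul

/-- The identity `μ(ℓ^⊥) + q μ(ℓ) = m (q + 1)` for a hyperbolic line `ℓ`, combined with
`μ(ℓ) ≥ 2`. -/
theorem card_cone_perp_pair_le {x y : V} (hx : x ∈ Ω) (hy : y ∈ Ω) (hxy : B y x ≠ 0) :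
    ((Ω.filter fun u => B u x = 0 ∧ B u y = 0).card : ℤ) ≤
      (q ^ 2 - 1) * (m * (q + 1) - 2 * q) := by
  have hq2 : (2 : ℤ) ≤ q := by exact_mod_cast one_lt_of_card_eq_sq hq
  have hq1 : (0 : ℤ) < q ^ 2 - 1 := by nlinarith
  have hx0 := hne x hx
  have hyx : y ∉ Submodule.span F {x} := by
    intro h
    obtain ⟨c, rfl⟩ := Submodule.mem_span_singleton.1 h
    simp [hiso x hx] at hxy
  set L := Submodule.span F {x, y} with hL
  have hLfin : Module.finrank F L = 2 := finrank_span_pair hx0 hyx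
  have hxL : x ∈ L := Submodule.subset_span (by simp)
  have hyL : y ∈ L := Submodule.subset_span (by simp)
  set L₀ := Finset.univ.filter fun v : V => v ≠ 0 ∧ v ∈ L with hL₀
  have hL₀card : (L₀.card : ℤ) = q ^ 4 - 1 := by
    have h1 : L₀ = (Finset.univ.filter fun v : V => v ∈ L).erase 0 := by
      ext v; simp [hL₀]
    rw [h1, Finset.cast_card_erase_of_mem (by simp), card_filter_mem hq, hLfin]
    push_cast
    ring
  have hperps : ∑ v ∈ L₀, ((Ω.filter fun u => B u v = 0).card : ℤ) =
      (q ^ 4 - q ^ 2) * (Ω.filter fun u => B u x = 0 ∧ B u y = 0).card +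
        (q ^ 2 - 1) * Ω.card := by
    have hswap := Finset.sum_card_bipartiteAbove_eq_sum_card_bipartiteBelow
      (s := L₀) (t := Ω) (fun v u => B u v = 0)
    simp only [Finset.bipartiteAbove, Finset.bipartiteBelow] at hswap
    zify at hswap
    have hu : ∀ u ∈ Ω, ((L₀.filter fun v => B u v = 0).card : ℤ) =
        (if B u x = 0 ∧ B u y = 0 then (q : ℤ) ^ 4 - q ^ 2 else 0) + (q ^ 2 - 1) := by
      intro u _
      have h1 : (L₀.filter fun v => B u v = 0) = (Finset.univ.filter fun v : V =>
          v ∈ L ⊓ sperp B (Submodule.span F {u})).erase 0 := by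
        ext v
        simp only [hL₀, Finset.mem_filter, Finset.mem_univ, true_and, Finset.mem_erase,
          Submodule.mem_inf, mem_sperp_singleton hB, hB u v, map_eq_zero]
        tauto
      rw [h1, Finset.cast_card_erase_of_mem (by simp), card_filter_mem hq]
      split_ifs with h
      · have h2 : L ⊓ sperp B (Submodule.span F {u}) = L := by
          rw [inf_eq_left, hL, Submodule.span_le]
          rintro v (rfl | rfl) <;> rw [SetLike.mem_coe, mem_sperp_singleton hB, hB u]
          · rw [h.1, map_zero]
          · rw [h.2, map_zero]
        rw [h2, hLfin]
        push_cast
        ring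
      · have h2 : Module.finrank F ↥(L ⊓ sperp B (Submodule.span F {u})) + 1 =
            Module.finrank F L := by
          by_cases h3 : B u x = 0
          · refine finrank_inf_sperp_singleton hB hyL fun h4 => h ⟨h3, ?_⟩
            rw [hB y u, h4, map_zero]
          · refine finrank_inf_sperp_singleton hB hxL fun h4 => h3 ?_
            rw [hB x u, h4, map_zero]
        rw [show Module.finrank F ↥(L ⊓ sperp B (Submodule.span F {u})) = 1 by omega]
        push_cast
        ring
    rw [hswap, Finset.sum_congr rfl hu, Finset.sum_add_distrib, ← Finset.sum_filter]
    simp only [Finset.sum_const, nsmul_eq_mul]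
    ring
  have hspans : 2 * ((q : ℤ) ^ 2 - 1) ^ 2 ≤
      ∑ v ∈ L₀, ((Ω.filter fun u => u ∈ Submodule.span F {v}).card : ℤ) := by
    have hdisj : Disjoint (L₀.filter fun v => v ∈ Submodule.span F {x})
        (L₀.filter fun v => v ∈ Submodule.span F {y}) := by
      rw [Finset.disjoint_left]
      intro v hv hv'
      simp only [hL₀, Finset.mem_filter, Finset.mem_univ, true_and] at hv hv'
      exact hyx ((Submodule.span_singleton_le_iff_mem _ _).2 hv.2
        (mem_span_singleton_comm hv.1.1 hv'.2))
    have hpart : ∀ w ∈ Ω, w ∈ L →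
        ∑ v ∈ L₀ with v ∈ Submodule.span F {w},
          ((Ω.filter fun u => u ∈ Submodule.span F {v}).card : ℤ) = (q ^ 2 - 1) ^ 2 := by
      intro w hw hwL
      have h1 : (L₀.filter fun v => v ∈ Submodule.span F {w}) =
          Finset.univ.filter fun v : V => v ≠ 0 ∧ v ∈ Submodule.span F {w} := by
        ext v
        simp only [hL₀, Finset.mem_filter, Finset.mem_univ, true_and]
        exact ⟨fun h => ⟨h.1.1, h.2⟩, fun h =>
          ⟨⟨h.1, (Submodule.span_singleton_le_iff_mem _ _).2 hwL h.2⟩, h.2⟩⟩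
      have h2 : ∀ v ∈ Finset.univ.filter fun v : V => v ≠ 0 ∧ v ∈ Submodule.span F {w},
          ((Ω.filter fun u => u ∈ Submodule.span F {v}).card : ℤ) = q ^ 2 - 1 := by
        intro v hv
        simp only [Finset.mem_filter, Finset.mem_univ, true_and] at hv
        refine card_cone_inter_span hq Ω hne hsmul ?_
        obtain ⟨c, rfl⟩ := Submodule.mem_span_singleton.1 hv.2
        exact hsmul w hw c (by rintro rfl; simp at hv)
      rw [h1, Finset.sum_congr rfl h2, Finset.sum_const, nsmul_eq_mul,
        card_span_singleton_ne_zero hq (hne w hw), sq ((q : ℤ) ^ 2 - 1)]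
    have h := Finset.sum_le_sum_of_subset_of_nonneg
      (Finset.union_subset (Finset.filter_subset (fun v => v ∈ Submodule.span F {x}) L₀)
        (Finset.filter_subset (fun v => v ∈ Submodule.span F {y}) L₀))
      (f := fun v => ((Ω.filter fun u => u ∈ Submodule.span F {v}).card : ℤ))
      (fun _ _ _ => Nat.cast_nonneg _)
    rw [Finset.sum_union hdisj, hpart x hx hxL, hpart y hy hyL] at h
    linarith
  have hsum := Finset.sum_congr rfl fun v (hv : v ∈ L₀) =>
    card_cone_perp_add hq hσ hσσ hB hnd hV Ω hne hiso hline
      (v := v) (by simp only [hL₀, Finset.mem_filter] at hv; exact hv.2.1)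
  rw [Finset.sum_add_distrib, ← Finset.mul_sum, Finset.sum_const, nsmul_eq_mul, hL₀card,
    hperps, card_cone hq hσ hσσ hB hnd hV Ω hne hiso hline] at hsum
  have h3 := mul_le_mul_of_nonneg_left hspans (by positivity : (0 : ℤ) ≤ q ^ 3)
  refine le_of_mul_le_mul_left (a := (q : ℤ) ^ 2 * (q ^ 2 - 1)) ?_ (by positivity)
  linarith

/-- The quadratic inequality obtained by counting pairs `(y, w)` of points of the ovoid with `y`
not collinear to a fixed point `x` of the ovoid and `w` collinear to both. -/
theorem quadratic_inequality
    (hrank : ∀ z w u, z ≠ 0 → w ∉ Submodule.span F {z} → B z z = 0 → B w w = 0 → B u u = 0 →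
      B w z = 0 → B u z = 0 → B u w = 0 → u ∈ Submodule.span F {z, w})
    (hΩ : Ω.Nonempty) :
    (q ^ 3 + 2 * q + 1 : ℤ) ≤ (q + 1) * (m ^ 2 * (q - 2) + 3 * m) := by
  have hq2 : (2 : ℤ) ≤ q := by exact_mod_cast one_lt_of_card_eq_sq hq
  have hq1 : (0 : ℤ) < q ^ 2 - 1 := by nlinarith
  obtain ⟨x, hx⟩ := hΩ
  have hx0 := hne x hx
  have hN := card_cone hq hσ hσσ hB hnd hV Ω hne hiso hline
  have hT : ∀ z ∈ Ω, ((Ω.filter fun u => B u z = 0).card : ℤ) =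
      m * (q ^ 2 - 1) * (q ^ 3 + 1) - q ^ 3 * (q ^ 2 - 1) := fun z hz => by
    have h := card_cone_perp_add hq hσ hσσ hB hnd hV Ω hne hiso hline (hne z hz)
    rw [card_cone_inter_span hq Ω hne hsmul hz] at h
    linear_combination h
  set Y := Ω.filter fun y => B y x ≠ 0 with hY
  have hYcard : (Y.card : ℤ) = Ω.card - (Ω.filter fun u => B u x = 0).card := by
    have h := Finset.card_filter_add_card_filter_not (s := Ω) (fun u => B u x = 0)
    zify at h
    rw [hY]
    linear_combination h
  have hswap := Finset.sum_card_bipartiteAbove_eq_sum_card_bipartiteBelow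
    (s := Y) (t := Ω.filter fun z => B z x = 0) (fun y z => B z y = 0)
  simp only [Finset.bipartiteAbove, Finset.bipartiteBelow, Finset.filter_filter] at hswap
  zify at hswap
  have hupper : ∑ y ∈ Y, ((Ω.filter fun z => B z x = 0 ∧ B z y = 0).card : ℤ) ≤
      Y.card * ((q ^ 2 - 1) * (m * (q + 1) - 2 * q)) := by
    rw [← nsmul_eq_mul, ← Finset.sum_const]
    refine Finset.sum_le_sum fun y hy => ?_
    rw [hY, Finset.mem_filter] at hy
    exact card_cone_perp_pair_le hq hσ hσσ hB hnd hV Ω hne hiso hsmul hline hx hy.1 hy.2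
  set Z := Ω.filter fun z => B z x = 0 ∧ z ∉ Submodule.span F {x} with hZ
  have hZcard : (Z.card : ℤ) = (q ^ 2 - 1) * ((m - 1) * (q ^ 3 + 1)) := by
    have h := Finset.card_filter_add_card_filter_not (s := Ω.filter fun z => B z x = 0)
      (fun z => z ∈ Submodule.span F {x})
    rw [Finset.filter_filter, Finset.filter_filter, ← hZ] at h
    have h1 : (Ω.filter fun z => B z x = 0 ∧ z ∈ Submodule.span F {x}) =
        Ω.filter fun z => z ∈ Submodule.span F {x} := by
      refine Finset.filter_congr fun z _ => ⟨fun h => h.2, fun h => ⟨?_, h⟩⟩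
      obtain ⟨c, rfl⟩ := Submodule.mem_span_singleton.1 h
      simp [hiso x hx]
    rw [h1] at h
    zify at h
    rw [card_cone_inter_span hq Ω hne hsmul hx, hT x hx] at h
    linear_combination h
  have hlower : Z.card * ((q ^ 2 - 1) * (q ^ 3 * (m - 1))) ≤
      ∑ z ∈ Ω with B z x = 0, ((Y.filter fun y => B z y = 0).card : ℤ) := by
    have hsub : Z ⊆ Ω.filter fun z => B z x = 0 := fun z hz => by
      rw [hZ, Finset.mem_filter] at hz
      exact Finset.mem_filter.2 ⟨hz.1, hz.2.1⟩
    refine le_trans ?_ (Finset.sum_le_sum_of_subset_of_nonneg hsub fun _ _ _ => Nat.cast_nonneg _)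
    rw [← nsmul_eq_mul, ← Finset.sum_const]
    refine Finset.sum_le_sum fun z hz => le_of_eq ?_
    rw [hZ, Finset.mem_filter] at hz
    have h := Finset.card_filter_add_card_filter_not (s := Ω.filter fun y => B y z = 0)
      (fun y => B y x = 0)
    rw [Finset.filter_filter, Finset.filter_filter] at h
    have h1 : (Ω.filter fun y => B y z = 0 ∧ B y x = 0) =
        Ω.filter fun y => y ∈ Submodule.span F {x, z} := by
      refine Finset.filter_congr fun y hy => ⟨fun h => ?_, fun h => ?_⟩
      · exact hrank x z y hx0 hz.2.2 (hiso x hx) (hiso z hz.1) (hiso y hy) hz.2.1 h.2 h.1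
      · obtain ⟨a, b, rfl⟩ := Submodule.mem_span_pair.1 h
        have h2 : B x z = 0 := by rw [hB z x, hz.2.1, map_zero]
        simp [hiso x hx, hiso z hz.1, hz.2.1, h2]
    have h2 : (Y.filter fun y => B z y = 0) = Ω.filter fun y => B y z = 0 ∧ ¬B y x = 0 := by
      ext y
      simp only [hY, Finset.mem_filter, hB y z, map_eq_zero]
      tauto
    rw [h1] at h
    zify at h
    rw [hT z hz.1, hline x z hx0 hz.2.2 (hiso x hx) (hiso z hz.1) hz.2.1] at h
    rw [h2]
    linear_combination -h
  rw [hswap] at hupper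
  have hfinal := hlower.trans hupper
  rw [hZcard, hYcard, hN, hT x hx] at hfinal
  have hpos : (0 : ℤ) < (q ^ 2 - 1) ^ 2 * q ^ 3 := by positivity
  refine le_of_mul_le_mul_left (a := ((q : ℤ) ^ 2 - 1) ^ 2 * q ^ 3) ?_ hpos
  linarith

end Sizes

end Cone

end HermitianCounts

section Bridge

variable {F V : Type} [Field F] [AddCommGroup V] [Module F V]

theorem mk_smul_rep (p : Projectivization F V) (c : Fˣ) (h : (c : F) • p.rep ≠ 0) :
    Projectivization.mk F ((c : F) • p.rep) h = p := by
  conv_rhs => rw [← p.mk_rep]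
  exact (Projectivization.mk_eq_mk_iff F _ _ h p.rep_nonzero).2 ⟨c, rfl⟩

theorem rep_mk_mem_iff {W : Submodule F V} {v : V} (h : v ≠ 0) :
    (Projectivization.mk F v h).rep ∈ W ↔ v ∈ W := by
  obtain ⟨a, ha⟩ := Projectivization.exists_smul_eq_mk_rep F v h
  rw [← ha]
  exact W.smul_mem_iff' a

/-- Each point of a projective subspace is represented by `|F| - 1` vectors. -/
theorem card_vectors_of_points [Fintype F] [Fintype V] (O : Set (Projectivization F V))
    (W : Submodule F V) :
    Nat.card {v : V // (∃ h : v ≠ 0, Projectivization.mk F v h ∈ O) ∧ v ∈ W} =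
      (pts W ∩ O).ncard * (Fintype.card F - 1) := by
  have hne : ∀ (p : Projectivization F V) (c : Fˣ), (c : F) • p.rep ≠ 0 := fun p c =>
    smul_ne_zero c.ne_zero p.rep_nonzero
  let f : ↥(pts W ∩ O) × Fˣ →
      {v : V // (∃ h : v ≠ 0, Projectivization.mk F v h ∈ O) ∧ v ∈ W} := fun a =>
    ⟨(a.2 : F) • a.1.1.rep, ⟨hne _ _, by rw [mk_smul_rep]; exact a.1.2.2⟩,
      W.smul_mem _ a.1.2.1⟩
  have hf : Function.Bijective f := by
    constructor
    · rintro ⟨⟨p, hp⟩, c⟩ ⟨⟨p', hp'⟩, c'⟩ h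
      have h1 : (c : F) • p.rep = (c' : F) • p'.rep := congrArg Subtype.val h
      have h2 : p = p' := by
        rw [← mk_smul_rep p c (hne _ _), ← mk_smul_rep p' c' (hne _ _)]
        simp only [h1]
      subst h2
      have h3 : c = c' := Units.ext (smul_left_injective F p.rep_nonzero h1)
      subst h3
      rfl
    · rintro ⟨v, ⟨hv, hvO⟩, hvW⟩
      obtain ⟨a, ha⟩ := Projectivization.exists_smul_eq_mk_rep F v hv
      refine ⟨⟨⟨Projectivization.mk F v hv, (rep_mk_mem_iff hv).2 hvW, hvO⟩, a⁻¹⟩, ?_⟩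
      apply Subtype.ext
      change ((a⁻¹ : Fˣ) : F) • (Projectivization.mk F v hv).rep = v
      rw [← ha]
      exact inv_smul_smul a v
  rw [← Nat.card_eq_of_bijective f hf, Nat.card_prod, Nat.card_coe_set_eq, Nat.card_units,
    Nat.card_eq_fintype_card]

theorem apply_eq_zero_of_mem_span {σ : F →+* F} {B : V →ₗ[F] V →ₛₗ[σ] F} {s : Set V}
    (h : ∀ a ∈ s, ∀ b ∈ s, B a b = 0) :
    ∀ v ∈ Submodule.span F s, ∀ w ∈ Submodule.span F s, B v w = 0 := by
  intro v hv w hw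
  induction hv, hw using Submodule.span_induction₂ with
  | mem_mem x y hx hy => exact h x hx y hy
  | zero_left y hy => simp
  | zero_right x hx => simp
  | add_left x y z _ _ _ h1 h2 => simp [h1, h2]
  | add_right x y z _ _ _ h1 h2 => simp [h1, h2]
  | smul_left r x y _ _ h1 => simp [h1]
  | smul_right r x y _ _ h1 => simp [h1]

end Bridge

open Classical in
theorem PolarSpace.quadratic_inequality_of_ovoid {F : Type} [Field F] [Fintype F] {q m : ℕ}
    (hq : Fintype.card F = q ^ 2) (P : PolarSpace F 2 PolarKind.hermitian)
    (O : Set (Projectivization F (Fin (PolarKind.hermitian.vdim 2) → F)))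
    (hO : P.IsNontrivialMOvoid m O) :
    (q ^ 3 + 2 * q + 1 : ℤ) ≤ (q + 1) * (m ^ 2 * (q - 2) + 3 * m) := by
  obtain ⟨⟨hOs, hgen⟩, hm0, -⟩ := hO
  obtain ⟨hσ, hσσ, hB, hsing, hti⟩ := P.spec
  have hV : Module.finrank F (Fin (PolarKind.hermitian.vdim 2) → F) = 5 := by
    rw [Module.finrank_fin_fun]
    rfl
  have hq1 := one_lt_of_card_eq_sq hq
  set Ω := Finset.univ.filter fun v : Fin (PolarKind.hermitian.vdim 2) → F =>
    ∃ h : v ≠ 0, Projectivization.mk F v h ∈ O with hΩ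
  have hmem : ∀ v, v ∈ Ω ↔ ∃ h : v ≠ 0, Projectivization.mk F v h ∈ O := by simp [hΩ]
  have hti_pair : ∀ s : Set (Fin (PolarKind.hermitian.vdim 2) → F),
      (∀ a ∈ s, ∀ b ∈ s, P.B a b = 0) → P.ti (Submodule.span F s) := fun s h =>
    (hti _).2 (apply_eq_zero_of_mem_span h)
  refine quadratic_inequality hq hσ (fun x => RingHom.congr_fun hσσ x) hB P.nondeg hV Ω
    (fun u hu => ((hmem u).1 hu).1) ?_ ?_ ?_ ?_ ?_
  · intro u hu
    obtain ⟨h0, hu⟩ := (hmem u).1 hu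
    have h1 := hOs hu
    rw [hsing] at h1
    have h2 : P.B (Projectivization.mk F u h0).rep (Projectivization.mk F u h0).rep = 0 := h1
    obtain ⟨a, ha⟩ := Projectivization.exists_smul_eq_mk_rep F u h0
    rw [← ha, Units.smul_def] at h2
    simpa using h2
  · intro u hu c hc
    obtain ⟨h0, hu⟩ := (hmem u).1 hu
    refine (hmem _).2 ⟨smul_ne_zero hc h0, ?_⟩
    rwa [(Projectivization.mk_eq_mk_iff F _ _ (smul_ne_zero hc h0) h0).2 ⟨Units.mk0 c hc, rfl⟩]
  · intro z w hz hw hzz hww hwz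
    have hzw : P.B z w = 0 := by rw [hB w z, hwz, map_zero]
    have hW : P.IsGenerator (Submodule.span F {z, w}) := by
      refine ⟨hti_pair _ ?_, finrank_span_pair hz hw⟩
      rintro a (rfl | rfl) b (rfl | rfl) <;> assumption
    have h := card_vectors_of_points O (Submodule.span F {z, w})
    rw [hgen _ hW, hq] at h
    have h1 : (Ω.filter fun u => u ∈ Submodule.span F {z, w}).card = m * (q ^ 2 - 1) := by
      rw [← h, hΩ, Finset.filter_filter, Nat.card_eq_fintype_card, Fintype.card_subtype]
    rw [h1, Nat.cast_mul, Nat.cast_sub (Nat.one_le_pow _ _ (by omega))]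
    push_cast
    rfl
  · intro z w u hz hw hzz hww huu hwz huz huw
    by_contra hu
    have hzw : P.B z w = 0 := by rw [hB w z, hwz, map_zero]
    have hzu : P.B z u = 0 := by rw [hB u z, huz, map_zero]
    have hwu : P.B w u = 0 := by rw [hB u w, huw, map_zero]
    have h3 : P.ti (Submodule.span F {u, z, w}) := by
      refine hti_pair _ ?_
      rintro a (rfl | rfl | rfl) b (rfl | rfl | rfl) <;> assumption
    have hlt : Submodule.span F {z, w} < Submodule.span F {u, z, w} :=
      lt_of_le_of_ne (Submodule.span_mono (Set.subset_insert _ _))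
        fun h => hu (h ▸ Submodule.subset_span (Set.mem_insert _ _))
    have h4 := Submodule.finrank_lt_finrank_of_lt hlt
    rw [finrank_span_pair hz hw] at h4
    exact absurd (P.rank_le _ h3) (by omega)
  · obtain ⟨W, hW⟩ := P.rank_exists
    have h1 : (pts W ∩ O).Nonempty := by
      rw [← Set.ncard_pos, hgen W hW]
      exact hm0
    obtain ⟨p, -, hp⟩ := h1
    exact ⟨p.rep, (hmem _).2 ⟨p.rep_nonzero, by rwa [p.mk_rep]⟩⟩

/-- Theorem 4.4 / [BDS, Theorem 9.1]: if `O` is a non-trivial `m`-ovoid of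
the Hermitian polar space `H(4,q²)` with `q > 2`, then
`m ≥ (−3q − 3 + √(4q⁵ − 4q⁴ + 5q² − 2q + 1))/(2(q² − q − 2))`. -/
theorem hermitian_H4_ovoid_lower_bound
    {F : Type} [Field F] [Fintype F] {q m : ℕ} (hq : Fintype.card F = q ^ 2)
    (hq2 : 2 < q) (P : PolarSpace F 2 PolarKind.hermitian)
    (O : Set (Projectivization F (Fin (PolarKind.hermitian.vdim 2) → F)))
    (hO : P.IsNontrivialMOvoid m O) :
    (m : ℝ) ≥
      (-3 * (q : ℝ) - 3 +
          Real.sqrt (4 * (q : ℝ) ^ 5 - 4 * (q : ℝ) ^ 4 + 5 * (q : ℝ) ^ 2 - 2 * (q : ℝ) + 1))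
        / (2 * ((q : ℝ) ^ 2 - (q : ℝ) - 2)) := by
  have h := P.quadratic_inequality_of_ovoid hq O hO
  have h' : (q : ℝ) ^ 3 + 2 * q + 1 ≤ (q + 1) * (m ^ 2 * (q - 2) + 3 * m) := by exact_mod_cast h
  have hq3 : (3 : ℝ) ≤ q := by exact_mod_cast hq2
  have hpos : (0 : ℝ) < (q : ℝ) ^ 2 - q - 2 := by nlinarith
  have hsqrt : Real.sqrt (4 * (q : ℝ) ^ 5 - 4 * (q : ℝ) ^ 4 + 5 * (q : ℝ) ^ 2 - 2 * (q : ℝ) + 1) ≤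
      2 * m * ((q : ℝ) ^ 2 - q - 2) + 3 * q + 3 := by
    rw [Real.sqrt_le_iff]
    refine ⟨by positivity, ?_⟩
    have h1 := mul_le_mul_of_nonneg_left h' hpos.le
    linarith
  rw [ge_iff_le, div_le_iff₀ (by positivity)]
  linarith

end PolarOvoids
end
end

section
/- Let O be an m-ovoid of the polar space P'_{r,e} with weight function μ, r ≥ 2, and let π be an (r−2)-dimensional totally isotropic projective subspace contained in P'_{r,e}. Then Σ_{s ∈ PG(n,q)∖π^⊥} μ(s^⊥ ∩ π) = μ(π)·q^{r+2e−1}·(q^{r−2}−1)/(q−1), where the sum is over the points s of PG(n,q) not in π^⊥. -/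
noncomputable section

open scoped BigOperators

namespace PolarOvoids

/-- The number of projective points of a submodule `U` is `(q ^ dim U - 1) / (q - 1)`. -/
theorem ncard_pts_mul {F V : Type} [Field F] [Fintype F] [AddCommGroup V] [Module F V]
    [FiniteDimensional F V] (U : Submodule F V) :
    ((pts U).ncard : ℝ) * ((Fintype.card F : ℝ) - 1)
      = (Fintype.card F : ℝ) ^ Module.finrank F U - 1 := by
  have hpts : pts U = Set.range (Projectivization.map U.subtype U.subtype_injective) := by
    ext p
    constructor
    · intro hp
      refine ⟨Projectivization.mk F ⟨p.rep, hp⟩ fun h => p.rep_nonzero (congrArg Subtype.val h), ?_⟩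
      exact p.mk_rep
    · rintro ⟨s, rfl⟩
      induction s with
      | h v hv =>
        obtain ⟨a, ha⟩ := Projectivization.exists_smul_eq_mk_rep F (v : V)
          (fun h => hv (Subtype.ext h))
        change (Projectivization.mk F (v : V) _).rep ∈ U
        rw [← ha]
        exact U.smul_mem (a : F) v.2
  have : Finite U := Module.finite_of_finite F
  have hcard := Projectivization.card' F U
  rw [Module.natCard_eq_pow_finrank (K := F) (V := U), Nat.card_eq_fintype_card] at hcard
  rw [hpts, ← Set.image_univ, Set.ncard_image_of_injective _
    (Projectivization.map_injective _ U.subtype_injective), Set.ncard_univ]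
  have hq : 1 ≤ Fintype.card F := Fintype.card_pos
  rw [← Nat.cast_one, ← Nat.cast_sub hq, ← Nat.cast_mul, ← Nat.cast_pow, hcard]
  simp

theorem pts_mono {F V : Type} [Field F] [AddCommGroup V] [Module F V] {U W : Submodule F V}
    (h : U ≤ W) : pts U ⊆ pts W := fun _ hp => h hp

/-- Double counting of a relation between two sets of a finite type. -/
theorem finsum_mem_ncard_comm {X : Type} [Finite X] (S T : Set X) (R : X → X → Prop) :
    ∑ᶠ s ∈ S, (({t ∈ T | R s t}.ncard : ℕ) : ℝ)
      = ∑ᶠ t ∈ T, (({s ∈ S | R s t}.ncard : ℕ) : ℝ) := by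
  classical
  have := Fintype.ofFinite X
  rw [finsum_mem_eq_toFinset_sum, finsum_mem_eq_toFinset_sum]
  have h := Finset.sum_card_bipartiteAbove_eq_sum_card_bipartiteBelow
    (s := S.toFinset) (t := T.toFinset) R
  convert congrArg (fun n : ℕ => (n : ℝ)) h using 1 <;> rw [Nat.cast_sum] <;>
    refine Finset.sum_congr rfl fun x _ => ?_ <;> congr 1 <;>
    rw [Set.ncard_eq_toFinset_card'] <;> congr 1 <;> ext y <;>
    simp [Finset.bipartiteAbove, Finset.bipartiteBelow]

/-- The dimension formula for orthogonal complements under a non-degenerate reflexive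
sesquilinear form over a finite field. -/
theorem finrank_sperp_add {F V : Type} [Field F] [Finite F] [AddCommGroup V] [Module F V]
    [FiniteDimensional F V] {σ : F →+* F} (B : V →ₗ[F] V →ₛₗ[σ] F)
    (hrefl : ∀ v w, B v w = 0 → B w v = 0) (hnd : ∀ v, (∀ w, B v w = 0) → v = 0)
    (W : Submodule F V) :
    Module.finrank F (sperp B W) + Module.finrank F W = Module.finrank F V := by
  let b := Module.finBasis F W
  let φ : V →ₗ[F] (Fin (Module.finrank F W) → F) :=
    LinearMap.pi fun i =>
      { toFun := fun v => B v (b i)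
        map_add' := fun x y => by simp
        map_smul' := fun c x => by simp }
  have hφ : ∀ v i, φ v i = B v (b i) := fun _ _ => rfl
  have hker : LinearMap.ker φ = sperp B W := by
    ext v
    constructor
    · intro hv w hw
      apply hrefl
      have hw' := congrArg (Subtype.val) (b.sum_repr ⟨w, hw⟩)
      change _ = w at hw'
      rw [← hw']
      have hv' : ∀ i, B v (b i) = 0 := fun i => by
        rw [← hφ, LinearMap.mem_ker.mp hv, Pi.zero_apply]
      simp only [Submodule.coe_sum, Submodule.coe_smul, map_sum, map_smulₛₗ, hv', smul_zero,
        Finset.sum_const_zero]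
    · intro hv
      rw [LinearMap.mem_ker]
      funext i
      exact hrefl _ _ (hv _ (b i).2)
  have hrange : LinearMap.range φ = ⊤ := by
    by_contra hne
    obtain ⟨f, hf, hle⟩ := Submodule.exists_le_ker_of_lt_top _ (lt_top_iff_ne_top.mpr hne)
    have hσ : Function.Surjective σ := Finite.surjective_of_injective σ.injective
    choose d hd using fun i => hσ (f (Pi.single i 1))
    have hsum : ∀ v, B v ((∑ i, d i • b i : W) : V) = 0 := by
      intro v
      have h0 : f (φ v) = 0 := hle ⟨v, rfl⟩
      rw [LinearMap.pi_apply_eq_sum_univ f (φ v)] at h0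
      simp only [hφ, smul_eq_mul] at h0
      simp only [Submodule.coe_sum, Submodule.coe_smul, map_sum, map_smulₛₗ, hd, smul_eq_mul]
      rw [← h0]
      refine Finset.sum_congr rfl fun i _ => ?_
      rw [mul_comm]
      congr 2
      ext j
      simp [Pi.single_apply, eq_comm]
    have hzero : (∑ i, d i • b i : W) = 0 :=
      Subtype.ext (hnd _ fun w => hrefl _ _ (hsum w))
    have hd0 := Fintype.linearIndependent_iff.mp b.linearIndependent d hzero
    apply hf
    refine LinearMap.pi_ext' fun i => LinearMap.ext_ring ?_
    simp [← hd, hd0]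
  have := φ.finrank_range_add_finrank_ker
  rw [hker, hrange, finrank_top, Module.finrank_fin_fun] at this
  omega

namespace PolarSpace

theorem reflexive {F : Type} [Field F] {r : ℕ} {k : PolarKind} (P : PolarSpace F r k)
    (v w : Fin (k.vdim r) → F) (h : P.B v w = 0) : P.B w v = 0 := by
  revert h
  obtain ⟨σ, B, nd, sing, ti, spec, -, -⟩ := P
  intro h
  change B v w = 0 at h
  change B w v = 0
  cases k with
  | symplectic =>
    obtain ⟨-, halt, -⟩ := spec
    have := halt (v + w)
    simpa [halt, h] using this
  | hermitian =>
    obtain ⟨-, -, hherm, -⟩ := spec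
    simpa [h] using hherm v w
  | elliptic =>
    obtain ⟨-, Q, hQ, -⟩ := spec
    rw [← hQ, QuadraticMap.polar_comm, hQ]
    exact h

theorem finrank_perp_add {F : Type} [Field F] [Finite F] {r : ℕ} {k : PolarKind}
    (P : PolarSpace F r k) (W : Submodule F (Fin (k.vdim r) → F)) :
    Module.finrank F (P.perp W) + Module.finrank F W = k.vdim r := by
  rw [perp, finrank_sperp_add P.B P.reflexive P.nondeg, Module.finrank_fin_fun]

theorem mem_pperp {F : Type} [Field F] {r : ℕ} {k : PolarKind} (P : PolarSpace F r k)
    (p : Projectivization F (Fin (k.vdim r) → F)) (v : Fin (k.vdim r) → F) :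
    v ∈ P.pperp p ↔ P.B p.rep v = 0 := by
  constructor
  · intro h
    exact h _ (Submodule.mem_span_singleton_self _)
  · intro h w hw
    obtain ⟨c, rfl⟩ := Submodule.mem_span_singleton.mp hw
    simp [h]

theorem perp_le_pperp {F : Type} [Field F] {r : ℕ} {k : PolarKind} (P : PolarSpace F r k)
    {W : Submodule F (Fin (k.vdim r) → F)} {p : Projectivization F (Fin (k.vdim r) → F)}
    (hp : p ∈ pts W) : P.perp W ≤ P.pperp p :=
  fun v hv => (P.mem_pperp p v).mpr (hv _ hp)

end PolarSpace

theorem PolarKind.cast_vdim (k : PolarKind) (r : ℕ) :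
    (k.vdim r : ℝ) = 2 * r + 2 * k.e - 2 := by
  cases k <;> simp [PolarKind.vdim, PolarKind.e] <;> ring

/-- Lemma 5.1: if `O` is an `m`-ovoid of `P'_{r,e}` with weight function
`μ`, `r ≥ 2`, and `π` is an `(r−2)`-dimensional totally isotropic subspace contained in
`P'_{r,e}`, then `Σ_{s ∉ π^⊥} μ(s^⊥ ∩ π) = μ(π)·q^{r+2e−1}·(q^{r−2}−1)/(q−1)`. -/
theorem ovoid_tangent_hyperplane_sum
    {F : Type} [Field F] [Fintype F] {q r m : ℕ} (hq : Fintype.card F = q)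
    {k : PolarKind} (P : PolarSpace F r k) (hr : 2 ≤ r)
    (O : Set (Projectivization F (Fin (k.vdim r) → F)))
    (hO : P.IsMOvoid m O)
    (W : Submodule F (Fin (k.vdim r) → F)) (hti : P.ti W)
    (hW : Module.finrank F ↥W = r - 1) :
    ∑ᶠ s ∈ (pts (P.perp W))ᶜ, nwt O (pts (P.pperp s ⊓ W))
      = nwt O (pts W) * (q : ℝ) ^ ((r : ℝ) + 2 * k.e - 1) *
          (((q : ℝ) ^ ((r : ℝ) - 2) - 1) / ((q : ℝ) - 1)) := by
  subst hq
  have hq1 : (1 : ℝ) < Fintype.card F := mod_cast Fintype.one_lt_card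
  have hleft : ∀ s, nwt O (pts (P.pperp s ⊓ W))
      = (({p ∈ pts W ∩ O | P.B s.rep p.rep = 0}.ncard : ℕ) : ℝ) := by
    intro s
    unfold nwt
    congr 2
    ext p
    simp only [pts, Set.mem_inter_iff, Set.mem_ofPred_eq, Submodule.mem_inf, P.mem_pperp]
    tauto
  set d := Module.finrank F (P.perp W) with hd
  have hdW : d + (r - 1) = k.vdim r := by rw [hd, ← hW, P.finrank_perp_add]
  have hright : ∀ p ∈ pts W ∩ O,
      (({s ∈ (pts (P.perp W))ᶜ | P.B s.rep p.rep = 0}.ncard : ℕ) : ℝ)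
        = (Fintype.card F : ℝ) ^ d *
          (((Fintype.card F : ℝ) ^ (r - 2) - 1) / ((Fintype.card F : ℝ) - 1)) := by
    intro p hp
    have hset : {s ∈ (pts (P.perp W))ᶜ | P.B s.rep p.rep = 0}
        = pts (P.pperp p) \ pts (P.perp W) := by
      ext s
      have : P.B s.rep p.rep = 0 ↔ s ∈ pts (P.pperp p) :=
        ⟨fun h => (P.mem_pperp p _).mpr (P.reflexive _ _ h),
          fun h => P.reflexive _ _ ((P.mem_pperp p _).mp h)⟩
      simp only [Set.mem_ofPred_eq, Set.mem_sdiff, Set.mem_compl_iff, this, and_comm]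
    have hsub := pts_mono (P.perp_le_pperp hp.1)
    have hadd := Set.ncard_sdiff_add_ncard_of_subset hsub
    have hp1 : Module.finrank F (P.pperp p) = d + (r - 2) := by
      have h1 := P.finrank_perp_add (Submodule.span F {p.rep})
      rw [finrank_span_singleton p.rep_nonzero] at h1
      change Module.finrank F (P.pperp p) + 1 = _ at h1
      omega
    have hcard1 := ncard_pts_mul (P.pperp p)
    have hcard2 := ncard_pts_mul (P.perp W)
    rw [hset, ← mul_div_assoc, eq_div_iff (by linarith)]
    rw [hp1, ← hadd, pow_add] at hcard1
    push_cast at hcard1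
    linear_combination hcard1 - hcard2
  have hexp : (r : ℝ) + 2 * k.e - 1 = (d : ℝ) := by
    have h1 := k.cast_vdim r
    rw [← hdW] at h1
    push_cast [Nat.cast_sub (show 1 ≤ r by omega)] at h1
    linarith
  have hexp' : (r : ℝ) - 2 = ((r - 2 : ℕ) : ℝ) := by
    push_cast [Nat.cast_sub hr]
    ring
  rw [finsum_mem_congr rfl fun s _ => hleft s, finsum_mem_ncard_comm,
    finsum_mem_congr rfl hright, hexp, hexp', Real.rpow_natCast, Real.rpow_natCast,
    finsum_mem_eq_finite_toFinset_sum _ (Set.toFinite _), Finset.sum_const, nsmul_eq_mul,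
    ← Set.ncard_eq_toFinset_card, nwt, mul_assoc]

end PolarOvoids
end
end

section
/- Let O be an m-ovoid of the polar space P'_{r,e}, r ≥ 2. Then there exists an (r−2)-dimensional totally isotropic projective subspace contained in P'_{r,e} that contains at least min{m, r−1} points of O. -/
noncomputable section

open scoped BigOperators

namespace PolarOvoids

/-- Every dimension between those of two nested subspaces is attained by a subspace in between. -/
theorem exists_le_le_finrank_eq {K V : Type*} [Field K] [AddCommGroup V] [Module K V]
    [FiniteDimensional K V] {U G : Submodule K V} (hUG : U ≤ G) {n : ℕ}
    (hU : Module.finrank K U ≤ n) (hG : n ≤ Module.finrank K G) :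
    ∃ W : Submodule K V, U ≤ W ∧ W ≤ G ∧ Module.finrank K W = n := by
  induction n, hU using Nat.le_induction with
  | base => exact ⟨U, le_rfl, hUG, rfl⟩
  | succ n _ ih =>
    obtain ⟨W, hUW, hWG, hW⟩ := ih (by omega)
    obtain ⟨v, hvG, hvW⟩ : ∃ v ∈ G, v ∉ W := by
      by_contra! h
      have := Submodule.finrank_mono (show G ≤ W from h)
      omega
    exact ⟨W ⊔ Submodule.span K {v}, hUW.trans le_sup_left, sup_le hWG (by simpa using hvG),
      by rw [Submodule.finrank_sup_span_singleton hvW, hW]⟩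

/-- A subspace of a totally isotropic (totally singular) subspace is again of this kind. -/
theorem PolarSpace.ti_mono {F : Type} [Field F] {r : ℕ} {k : PolarKind} (P : PolarSpace F r k)
    {W G : Submodule F (Fin (k.vdim r) → F)} (hWG : W ≤ G) (hG : P.ti G) : P.ti W := by
  have hP := P.spec
  cases k with
  | elliptic =>
    obtain ⟨_, Q, _, _, h⟩ := hP
    exact (h W).2 fun v hv => (h G).1 hG v (hWG hv)
  | symplectic =>
    obtain ⟨_, _, _, h⟩ := hP
    exact (h W).2 fun v hv w hw => (h G).1 hG v (hWG hv) w (hWG hw)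
  | hermitian =>
    obtain ⟨_, _, _, _, h⟩ := hP
    exact (h W).2 fun v hv w hw => (h G).1 hG v (hWG hv) w (hWG hw)

/-- Lemma 5.3: if `O` is an `m`-ovoid of `P'_{r,e}`, `r ≥ 2`, then there
exists an `(r−2)`-dimensional totally isotropic subspace contained in `P'_{r,e}` containing
at least `min{m, r−1}` points of `O`. -/
theorem exists_heavy_subspace
    {F : Type} [Field F] [Fintype F] {q r m : ℕ} (hq : Fintype.card F = q)
    {k : PolarKind} (P : PolarSpace F r k) (hr : 2 ≤ r)
    (O : Set (Projectivization F (Fin (k.vdim r) → F)))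
    (hO : P.IsMOvoid m O) :
    ∃ W : Submodule F (Fin (k.vdim r) → F),
      P.ti W ∧ Module.finrank F ↥W = r - 1 ∧ min m (r - 1) ≤ (pts W ∩ O).ncard := by
  obtain ⟨G, hG, hGr⟩ := P.rank_exists
  obtain ⟨S, hS, hScard⟩ := Set.exists_subset_card_eq
    (s := pts G ∩ O) (n := min m (r - 1)) (by rw [hO.2 G ⟨hG, hGr⟩]; exact min_le_left _ _)
  have hfin : Finite (Projectivization F (Fin (k.vdim r) → F)) := Quotient.finite _
  have hUG : Submodule.span F (Projectivization.rep '' S) ≤ G := by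
    rw [Submodule.span_le]
    rintro _ ⟨p, hp, rfl⟩
    exact (hS hp).1
  have hU : Module.finrank F (Submodule.span F (Projectivization.rep '' S)) ≤ r - 1 := by
    have := Fintype.ofFinite (Projectivization.rep '' S)
    refine (finrank_span_le_card _).trans ?_
    rw [← Set.ncard_eq_toFinset_card']
    exact (Set.ncard_image_le S.toFinite).trans (hScard.trans_le (min_le_right _ _))
  obtain ⟨W, hUW, hWG, hW⟩ := exists_le_le_finrank_eq hUG hU (by omega)
  refine ⟨W, P.ti_mono hWG hG, hW, ?_⟩
  rw [← hScard]
  exact Set.ncard_le_ncard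
    (fun p hp => ⟨hUW (Submodule.subset_span ⟨p, hp, rfl⟩), (hS hp).2⟩) (Set.toFinite _)

end PolarOvoids
end
end
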